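/- For every integer k ≥ 3 and every real z < 2√(k−1), there are only finitely many finite connected k-regular graphs X (up to isomorphism) with second largest adjacency eigenvalue μ_1(X) ≤ z. -/

import Mathlib

def adjMat {V : Type*} [Fintype V] (G : SimpleGraph V) [DecidableRel G.Adj] :
    Matrix V V ℝ :=
  G.adjMatrix ℝ

def IsAdjEigenvalue {V : Type*} [Fintype V] (G : SimpleGraph V) [DecidableRel G.Adj]
    (μ : ℝ) : Prop :=
  ∃ v : V → ℝ, v ≠ 0 ∧ (adjMat G).mulVec v = μ • v

open Finset Matrix

/-- If every eigenvector of a real symmetric matrix `A` either has eigenvalue at most `z` or is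
orthogonal to `w`, then the quadratic form of `A` at `w` is at most `z` times the square of the
norm of `w`. -/
theorem dotProduct_mulVec_le_of_eigenvalue_le {V : Type*} [Fintype V] [DecidableEq V]
    {A : Matrix V V ℝ} (hA : A.IsHermitian) (w : V → ℝ) (z : ℝ)
    (h : ∀ (μ : ℝ) (e : V → ℝ), e ≠ 0 → A *ᵥ e = μ • e → μ ≤ z ∨ e ⬝ᵥ w = 0) :
    w ⬝ᵥ A *ᵥ w ≤ z * (w ⬝ᵥ w) := by
  set b := hA.eigenvectorBasis with hb
  have parseval : ∀ x y : V → ℝ, x ⬝ᵥ y = ∑ i, ((b i).ofLp ⬝ᵥ x) * ((b i).ofLp ⬝ᵥ y) := by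
    intro x y
    have := b.sum_inner_mul_inner (WithLp.toLp 2 x) (WithLp.toLp 2 y)
    simp only [EuclideanSpace.inner_eq_star_dotProduct, star_trivial] at this
    rw [dotProduct_comm x y, ← this]
    exact Finset.sum_congr rfl fun i _ => by rw [dotProduct_comm y]
  rw [parseval w (A *ᵥ w), parseval w w, Finset.mul_sum]
  refine Finset.sum_le_sum fun i _ => ?_
  have hne : (b i).ofLp ≠ 0 := fun h0 =>
    b.orthonormal.ne_zero i (by ext j; exact congrFun h0 j)
  have hAT : Aᵀ = A := by simpa [conjTranspose_eq_transpose_of_trivial] using hA.eq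
  have key : (b i).ofLp ⬝ᵥ A *ᵥ w = hA.eigenvalues i * ((b i).ofLp ⬝ᵥ w) := by
    rw [dotProduct_mulVec, ← mulVec_transpose, hAT, hb, hA.mulVec_eigenvectorBasis,
      smul_dotProduct, smul_eq_mul]
  rw [key]
  rcases h _ _ hne (hA.mulVec_eigenvectorBasis i) with hle | h0
  · nlinarith [mul_self_nonneg ((b i).ofLp ⬝ᵥ w)]
  · simp only [hb] at h0 ⊢
    simp [h0]

/-- The spherical function with eigenvalue `t` on the `k`-regular tree. -/
noncomputable def treeSphericalFunction (k t : ℝ) : ℕ → ℝ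
  | 0 => 1
  | 1 => t / k
  | n + 2 => (t * treeSphericalFunction k t (n + 1) - treeSphericalFunction k t n) / (k - 1)

theorem treeSphericalFunction_add_two {k t : ℝ} (hk : 1 < k) (n : ℕ) :
    (k - 1) * treeSphericalFunction k t (n + 2) =
      t * treeSphericalFunction k t (n + 1) - treeSphericalFunction k t n := by
  have : k - 1 ≠ 0 := by linarith
  rw [treeSphericalFunction]
  field_simp

theorem exists_treeSphericalFunction_nonpos {k t : ℝ} (hk : 1 < k) (ht : t < 2 * √(k - 1)) :
    ∃ n, treeSphericalFunction k t n ≤ 0 := by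
  by_contra! hpos
  set f := treeSphericalFunction k t with hf
  have hq : 0 < k - 1 := by linarith
  set δ := (2 * √(k - 1) - t) / (k - 1) with hδ
  have hδpos : 0 < δ := div_pos (by linarith) hq
  have step : ∀ n, f (n + 2) / f (n + 1) ≤ f (n + 1) / f n - δ := by
    intro n
    have h0 := hpos n
    have h1 := hpos (n + 1)
    have hrec : f (n + 2) = (t * f (n + 1) - f n) / (k - 1) := by
      rw [hf, ← treeSphericalFunction_add_two hk, mul_div_cancel_left₀ _ hq.ne']
    have hsq : √(k - 1) ^ 2 = k - 1 := Real.sq_sqrt hq.le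
    have : f (n + 1) / f n - δ - f (n + 2) / f (n + 1) =
        (√(k - 1) * f (n + 1) - f n) ^ 2 / ((k - 1) * f n * f (n + 1)) := by
      rw [hrec, hδ, sub_sq, mul_pow, hsq]
      field_simp
      ring
    have : 0 ≤ f (n + 1) / f n - δ - f (n + 2) / f (n + 1) := by
      rw [this]; positivity
    linarith
  have bound : ∀ n : ℕ, f (n + 1) / f n ≤ f 1 / f 0 - n * δ := by
    intro n
    induction n with
    | zero => simp
    | succ n ih =>
      push_cast
      linarith [step n]
  obtain ⟨n, hn⟩ := exists_nat_gt (f 1 / f 0 / δ)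
  rw [div_lt_iff₀ hδpos] at hn
  linarith [bound n, div_pos (hpos (n + 1)) (hpos n)]

/-- A nonnegative decreasing radial profile of finite support on the `k`-regular tree which is
a subsolution of the eigenvalue equation for `t < 2√(k-1)`. -/
theorem exists_radial_profile {k t : ℝ} (hk : 1 < k) (ht0 : 0 < t) (htk : t ≤ k)
    (ht : t < 2 * √(k - 1)) :
    ∃ (R : ℕ) (g : ℕ → ℝ), Antitone g ∧ (∀ i, 0 ≤ g i) ∧ 0 < g 0 ∧ (∀ i, R ≤ i → g i = 0) ∧
      t * g 0 ≤ k * g 1 ∧ ∀ i, t * g (i + 1) ≤ g i + (k - 1) * g (i + 2) := by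
  classical
  have hex := exists_treeSphericalFunction_nonpos hk ht
  set f := treeSphericalFunction k t with hf
  set R := Nat.find hex
  have hfR : f R ≤ 0 := Nat.find_spec hex
  have hpos : ∀ i, i < R → 0 < f i := fun i hi => not_le.1 (Nat.find_min hex hi)
  have hf0 : f 0 = 1 := by rw [hf, treeSphericalFunction]
  have hf1 : f 1 = t / k := by rw [hf, treeSphericalFunction]
  have hf1pos : 0 < f 1 := by rw [hf1]; exact div_pos ht0 (by linarith)
  have hR2 : 2 ≤ R := by
    by_contra! h
    interval_cases R <;> linarith
  have hdec : ∀ i, i < R → f (i + 1) ≤ f i := by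
    intro i
    induction i with
    | zero =>
      intro _
      rw [hf0, zero_add, hf1, div_le_one (by linarith)]
      exact htk
    | succ i ih =>
      intro hi
      have h1 := ih (by omega)
      have h2 := hpos _ hi
      have h3 : (k - 1) * f (i + 2) = t * f (i + 1) - f i := treeSphericalFunction_add_two hk i
      have h4 : t * f (i + 1) ≤ k * f (i + 1) := mul_le_mul_of_nonneg_right htk h2.le
      have h5 : (k - 1) * f (i + 2) ≤ (k - 1) * f (i + 1) := by linarith
      exact le_of_mul_le_mul_left h5 (by linarith)
  set g : ℕ → ℝ := fun i => if i < R then f i else 0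
  have hglt : ∀ i, i < R → g i = f i := fun i hi => if_pos hi
  have hgge : ∀ i, R ≤ i → g i = 0 := fun i hi => if_neg (by omega)
  have hg0 : ∀ i, 0 ≤ g i := by
    intro i
    rcases lt_or_ge i R with h | h
    · rw [hglt i h]; exact (hpos i h).le
    · rw [hgge i h]
  have hfg : ∀ i, i ≤ R → f i ≤ g i := by
    intro i hi
    rcases hi.lt_or_eq with h | rfl
    · rw [hglt i h]
    · rw [hgge _ le_rfl]; exact hfR
  refine ⟨R, g, antitone_nat_of_succ_le fun i => ?_, hg0, ?_, hgge, ?_, fun i => ?_⟩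
  · rcases lt_or_ge (i + 1) R with h | h
    · rw [hglt _ h, hglt i (by omega)]
      exact hdec i (by omega)
    · rw [hgge _ h]
      exact hg0 i
  · rw [hglt 0 (by omega), hf0]; exact one_pos
  · rw [hglt 0 (by omega), hglt 1 (by omega), hf0, hf1]
    rw [mul_div_cancel₀ _ (by linarith : k ≠ 0), mul_one]
  · have hk1 : 0 ≤ k - 1 := by linarith
    rcases lt_or_ge (i + 1) R with h | h
    · rw [hglt _ h, hglt i (by omega)]
      have h3 : (k - 1) * f (i + 2) = t * f (i + 1) - f i := treeSphericalFunction_add_two hk i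
      linarith [mul_le_mul_of_nonneg_left (hfg (i + 2) (by omega)) hk1]
    · rw [hgge _ h, mul_zero]
      exact add_nonneg (hg0 i) (mul_nonneg hk1 (hg0 _))

namespace SimpleGraph

variable {V : Type*} {G : SimpleGraph V}

theorem Connected.exists_adj_dist_eq (hG : G.Connected) {v x : V} {i : ℕ}
    (h : G.dist v x = i + 1) : ∃ y, G.Adj x y ∧ G.dist v y = i := by
  obtain ⟨p, hp⟩ := hG.exists_walk_length_eq_dist x v
  rw [G.dist_comm, h] at hp
  cases p with
  | nil => simp at hp
  | cons hadj q =>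
    rename_i y
    refine ⟨y, hadj, ?_⟩
    have h1 : G.dist v y ≤ i := by
      rw [G.dist_comm]
      refine (G.dist_le q).trans ?_
      simpa using hp.le
    have h2 := hG.dist_triangle (u := v) (v := y) (w := x)
    rw [dist_eq_one_iff_adj.2 hadj.symm] at h2
    omega

theorem Connected.dist_le_succ_of_adj (hG : G.Connected) {v x y : V} (h : G.Adj x y) :
    G.dist v y ≤ G.dist v x + 1 := by
  have := hG.dist_triangle (u := v) (v := x) (w := y)
  rwa [dist_eq_one_iff_adj.2 h] at this

variable [Fintype V] [DecidableRel G.Adj] {k : ℕ}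

theorem IsRegularOfDegree.card_dist_le (hk : G.IsRegularOfDegree k) (hG : G.Connected) (v : V)
    (m : ℕ) : #{x | G.dist v x ≤ m} ≤ (k + 1) ^ m := by
  classical
  induction m with
  | zero =>
    refine (Finset.card_le_card (t := {v}) fun x hx => ?_).trans (by simp)
    simp only [mem_filter, mem_univ, true_and, Nat.le_zero, hG.dist_eq_zero_iff] at hx
    simp [hx]
  | succ m ih =>
    have hsub : ({x | G.dist v x ≤ m + 1} : Finset V) ⊆
        ({x | G.dist v x ≤ m} : Finset V).biUnion fun x => insert x (G.neighborFinset x) := by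
      intro x hx
      simp only [mem_filter, mem_univ, true_and] at hx
      simp only [mem_biUnion, mem_filter, mem_univ, true_and, Finset.mem_insert,
        mem_neighborFinset]
      rcases Nat.le_succ_iff.1 hx with h | h
      · exact ⟨x, h, Or.inl rfl⟩
      · obtain ⟨y, hxy, hy⟩ := hG.exists_adj_dist_eq h
        exact ⟨y, hy.le, Or.inr hxy.symm⟩
    refine (Finset.card_le_card hsub).trans ((Finset.card_biUnion_le_card_mul _ _ (k + 1)
      fun x _ => ?_).trans ?_)
    · refine (Finset.card_insert_le _ _).trans ?_
      rw [card_neighborFinset_eq_degree, hk.degree_eq]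
    · rw [pow_succ]
      exact Nat.mul_le_mul_right _ ih

/-- A radial subsolution on the `k`-regular tree gives a subsolution on every connected
`k`-regular graph. -/
theorem IsRegularOfDegree.mul_le_adjMatrix_mulVec_dist (hk : G.IsRegularOfDegree k)
    (hG : G.Connected) {t : ℝ} {g : ℕ → ℝ} (hg : Antitone g) (h0 : t * g 0 ≤ k * g 1)
    (h1 : ∀ i, t * g (i + 1) ≤ g i + (k - 1) * g (i + 2)) (v x : V) :
    t * g (G.dist v x) ≤ (G.adjMatrix ℝ *ᵥ fun y => g (G.dist v y)) x := by
  classical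
  rw [adjMatrix_mulVec_apply]
  have hcard : #(G.neighborFinset x) = k := by
    rw [card_neighborFinset_eq_degree, hk.degree_eq]
  have hle : ∀ y ∈ G.neighborFinset x, g (G.dist v x + 1) ≤ g (G.dist v y) := fun y hy =>
    hg (hG.dist_le_succ_of_adj ((G.mem_neighborFinset x y).1 hy))
  rcases hd : G.dist v x with _ | i
  · rw [hd] at hle
    refine h0.trans ?_
    have := Finset.card_nsmul_le_sum _ _ _ hle
    rwa [hcard, nsmul_eq_mul] at this
  · rw [hd] at hle
    obtain ⟨y, hxy, hy⟩ := hG.exists_adj_dist_eq hd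
    have hmem : y ∈ G.neighborFinset x := (G.mem_neighborFinset x y).2 hxy
    refine (h1 i).trans ?_
    rw [← Finset.add_sum_erase _ _ hmem, hy]
    have := Finset.card_nsmul_le_sum ((G.neighborFinset x).erase y) _ _
      fun u hu => hle u (Finset.mem_of_mem_erase hu)
    rw [Finset.card_erase_of_mem hmem, hcard, nsmul_eq_mul,
      Nat.cast_pred (hcard ▸ Finset.card_pos.2 ⟨y, hmem⟩)] at this
    linarith

/-- On a connected regular graph, eigenvectors for the degree are constant. -/
theorem IsRegularOfDegree.eq_of_adjMatrix_mulVec_eq (hk : G.IsRegularOfDegree k)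
    (hG : G.Connected) {e : V → ℝ} (he : G.adjMatrix ℝ *ᵥ e = (k : ℝ) • e) (x y : V) :
    e x = e y := by
  classical
  refine (G.lapMatrix_mulVec_eq_zero_iff_forall_reachable.1 ?_) x y (hG.preconnected x y)
  ext v
  rw [lapMatrix_mulVec_apply, ← adjMatrix_mulVec_apply, he, hk.degree_eq]
  simp

/-- If all eigenvalues of a connected `k`-regular graph other than `k` are at most `z`, then
the quadratic form of the adjacency matrix is bounded by `z` on vectors of mean zero. -/
theorem IsRegularOfDegree.dotProduct_adjMatrix_mulVec_le (hk : G.IsRegularOfDegree k)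
    (hG : G.Connected) {z : ℝ} (hz : ∀ μ : ℝ, IsAdjEigenvalue G μ → μ = k ∨ μ ≤ z)
    {w : V → ℝ} (hw : ∑ x, w x = 0) :
    w ⬝ᵥ G.adjMatrix ℝ *ᵥ w ≤ z * (w ⬝ᵥ w) := by
  classical
  refine dotProduct_mulVec_le_of_eigenvalue_le (G.isHermitian_adjMatrix ℝ) w z
    fun μ e he hμ => ?_
  rcases hz μ ⟨e, he, hμ⟩ with rfl | h
  · right
    obtain ⟨v⟩ := hG.nonempty
    rw [dotProduct, Finset.sum_congr rfl fun x _ => by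
      rw [hk.eq_of_adjMatrix_mulVec_eq hG hμ x v], ← Finset.mul_sum, hw, mul_zero]
  · exact Or.inl h

end SimpleGraph

/-- For every `k ≥ 3` and real `z < 2√(k-1)`, there are only finitely many connected
`k`-regular graphs `X` with `μ₁(X) ≤ z`: there is a uniform bound `N` on their number of
vertices (which gives finiteness up to isomorphism). -/
theorem finiteness_small_mu (k : ℕ) (hk : 3 ≤ k) (z : ℝ)
    (hz : z < 2 * Real.sqrt (k - 1)) :
    ∃ N : ℕ, ∀ (n : ℕ) (G : SimpleGraph (Fin n)) (_ : DecidableRel G.Adj),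
      G.Connected → G.IsRegularOfDegree k →
      (∀ μ : ℝ, IsAdjEigenvalue G μ → μ = k ∨ μ ≤ z) →
      n ≤ N := by
  have hk3 : (3 : ℝ) ≤ k := by exact_mod_cast hk
  have hsqrt : 0 < √((k : ℝ) - 1) := Real.sqrt_pos.2 (by linarith)
  have hsq : √((k : ℝ) - 1) ^ 2 = k - 1 := Real.sq_sqrt (by linarith)
  obtain ⟨t, ht, ht2⟩ := exists_between (max_lt hz (mul_pos two_pos hsqrt))
  obtain ⟨hzt, ht0⟩ := max_lt_iff.1 ht
  obtain ⟨R, g, hanti, hnn, hpos, hsupp, hg0, hg1⟩ := exists_radial_profile (k := k) (t := t)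
    (by linarith) ht0 (by nlinarith [sq_nonneg (√((k : ℝ) - 1) - 1)]) ht2
  refine ⟨(k + 1) ^ (2 * R), fun n G _ hG hreg hev => ?_⟩
  by_contra! hn
  obtain ⟨u⟩ := hG.nonempty
  obtain ⟨v, huv⟩ : ∃ v, 2 * R < G.dist u v := by
    by_contra! h
    have := hreg.card_dist_le hG u (2 * R)
    rw [Finset.filter_true_of_mem fun x _ => h x, Finset.card_univ, Fintype.card_fin] at this
    omega
  let F : Fin n → Fin n → ℝ := fun c x => g (G.dist c x)
  have hFnn : ∀ c x, 0 ≤ F c x := fun c x => hnn _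
  have hFlt : ∀ c x, F c x ≠ 0 → G.dist c x < R := fun c x h => by
    by_contra! h'
    exact h (hsupp _ h')
  have hFself : ∀ c, 0 < F c c := fun c => by simpa [F] using hpos
  have hsum : ∀ c, 0 < ∑ x, F c x := fun c =>
    Finset.sum_pos' (fun x _ => hFnn c x) ⟨c, Finset.mem_univ c, hFself c⟩
  have hquad : ∀ c, t * (F c ⬝ᵥ F c) ≤ F c ⬝ᵥ G.adjMatrix ℝ *ᵥ F c := fun c => by
    rw [dotProduct, dotProduct, Finset.mul_sum]
    refine Finset.sum_le_sum fun x _ => ?_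
    have := mul_le_mul_of_nonneg_left
      (hreg.mul_le_adjMatrix_mulVec_dist hG hanti hg0 hg1 c x) (hFnn c x)
    calc t * (F c x * F c x) = F c x * (t * g (G.dist c x)) := by simp only [F]; ring
      _ ≤ _ := this
  have hnorm : ∀ c, 0 < F c ⬝ᵥ F c := fun c =>
    Finset.sum_pos' (fun x _ => mul_self_nonneg _)
      ⟨c, Finset.mem_univ c, mul_pos (hFself c) (hFself c)⟩
  have hfar : ∀ x y, F u x ≠ 0 → F v y ≠ 0 → 1 < G.dist x y := fun x y hx hy => by
    have h1 := hFlt u x hx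
    have h2 := hFlt v y hy
    have h3 := hG.dist_triangle (u := u) (v := x) (w := v)
    have h4 := hG.dist_triangle (u := x) (v := y) (w := v)
    rw [G.dist_comm (u := y)] at h4
    omega
  have horth : F u ⬝ᵥ F v = 0 := Finset.sum_eq_zero fun x _ => by
    by_contra h
    have := hfar x x (left_ne_zero_of_mul h) (right_ne_zero_of_mul h)
    simp at this
  have hcross : F u ⬝ᵥ G.adjMatrix ℝ *ᵥ F v = 0 := Finset.sum_eq_zero fun x _ => by
    rw [SimpleGraph.adjMatrix_mulVec_apply, Finset.mul_sum]
    refine Finset.sum_eq_zero fun y hy => ?_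
    by_contra h
    have := hfar x y (left_ne_zero_of_mul h) (right_ne_zero_of_mul h)
    rw [SimpleGraph.dist_eq_one_iff_adj.2 ((G.mem_neighborFinset x y).1 hy)] at this
    exact lt_irrefl _ this
  have hcross' : F v ⬝ᵥ G.adjMatrix ℝ *ᵥ F u = 0 := by
    rw [dotProduct_mulVec, ← mulVec_transpose, G.transpose_adjMatrix, dotProduct_comm, hcross]
  set a := ∑ x, F v x
  set b := ∑ x, F u x
  have hle := hreg.dotProduct_adjMatrix_mulVec_le hG hev (w := a • F u - b • F v) (by
    simp only [Pi.sub_apply, Pi.smul_apply, smul_eq_mul, Finset.sum_sub_distrib,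
      ← Finset.mul_sum]
    ring)
  simp only [mulVec_sub, mulVec_smul, dotProduct_sub, sub_dotProduct, dotProduct_smul,
    smul_dotProduct, smul_eq_mul, hcross, hcross', horth, dotProduct_comm (F v) (F u)] at hle
  have ha : 0 < a * a := mul_self_pos.2 (hsum v).ne'
  have hb : 0 < b * b := mul_self_pos.2 (hsum u).ne'
  have hu := mul_pos ha (hnorm u)
  have hv := mul_pos hb (hnorm v)
  have hqu := mul_le_mul_of_nonneg_left (hquad u) ha.le
  have hqv := mul_le_mul_of_nonneg_left (hquad v) hb.le
  nlinarith [mul_pos (sub_pos.2 hzt) hu, mul_pos (sub_pos.2 hzt) hv]
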